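/- Let H ≥ 2 and 1 ≤ κ ≤ H be integers, η ∈ (0,1], and set l = (H − κ + 1)(H − 2) + 1. Let m ≥ l and let W_1,…,W_m be H×H row-stochastic matrices such that for each t ∈ {1,…,m}: (W_t)_{ii} ≥ η for all i, and there exists a directed graph G_t on {1,…,H}, with self-loops at all vertices, having at least κ roots, such that (W_t)_{ji} ≥ η whenever (i,j) is an arc of G_t. Then there exists a subset S ⊆ {1,…,H} with |S| ≥ κ such that (W_m W_{m−1} ⋯ W_1)_{ij} ≥ η^l for every i ∈ {1,…,H} and every j ∈ S. -/

import Mathlib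

/-- `prodUpTo H W m = W (m-1) * ⋯ * W 1 * W 0`, the left product of the first `m` matrices
of the sequence `W` (so, with the sequence viewed as `W_1, W_2, …` via `W_t = W (t-1)`,
`prodUpTo H W m` is `W_m ⋯ W_2 W_1`). -/
def prodUpTo (H : ℕ) (W : ℕ → Matrix (Fin H) (Fin H) ℝ) : ℕ → Matrix (Fin H) (Fin H) ℝ
  | 0 => 1
  | k + 1 => W k * prodUpTo H W k

/-- In a rooted digraph, a proper vertex subset containing a root has an outgoing arc. -/
theorem exists_arc_leaving {V : Type*} {G : V → V → Prop} {j : V}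
    (hj : ∀ i, Relation.ReflTransGen G j i) {R : Finset V} (hjR : j ∈ R) {x : V} (hx : x ∉ R) :
    ∃ k ∈ R, ∃ i, i ∉ R ∧ G k i := by
  by_contra! h
  have key : ∀ i, Relation.ReflTransGen G j i → i ∈ R := by
    intro i hi
    induction hi with
    | refl => exact hjR
    | tail _ hbc ih =>
      by_contra hc
      exact h _ ih _ hc hbc
  exact hx (key x (hj x))

/-- If each of `n * d + 1` sets has at least `κ` elements, where `n = card V - κ + 1`, then at least
`κ` elements lie in more than `d` of the sets. -/
theorem le_card_filter_frequent {V : Type*} [Fintype V] [DecidableEq V] {κ d : ℕ} (hκ : 1 ≤ κ)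
    (hκV : κ ≤ Fintype.card V) (r : ℕ → Finset V)
    (hr : ∀ t < (Fintype.card V - κ + 1) * d + 1, κ ≤ (r t).card) :
    κ ≤ (Finset.univ.filter fun j : V =>
      d < ((Finset.range ((Fintype.card V - κ + 1) * d + 1)).filter fun t => j ∈ r t).card).card := by
  set l := (Fintype.card V - κ + 1) * d + 1 with hl
  by_contra! hS
  obtain ⟨T, hST, hT⟩ := Finset.exists_superset_card_eq (n := κ - 1) (Nat.le_sub_one_of_lt hS)
    (by omega)
  have hex : ∀ t, ∃ j : V, t < l → j ∈ r t ∧ j ∉ T := by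
    intro t
    by_cases ht : t < l
    · obtain ⟨j, hj, hjT⟩ := Finset.exists_mem_notMem_of_card_lt_card
        (s := T) (t := r t) (by have := hr t ht; omega)
      exact ⟨j, fun _ => ⟨hj, hjT⟩⟩
    · have : Nonempty V := Fintype.card_pos_iff.mp (by omega)
      exact ⟨Classical.arbitrary V, fun h => absurd h ht⟩
  choose f hf using hex
  have hcard : (Tᶜ).card = Fintype.card V - κ + 1 := by
    rw [Finset.card_compl, hT]; omega
  obtain ⟨y, hy, hlt⟩ := Finset.exists_lt_card_fiber_of_mul_lt_card_of_maps_to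
    (s := Finset.range l) (t := Tᶜ) (f := f) (n := d)
    (fun t ht => by simpa using (hf t (Finset.mem_range.mp ht)).2)
    (by rw [hcard, Finset.card_range, hl]; omega)
  refine Finset.mem_compl.mp hy (hST ?_)
  refine Finset.mem_filter.mpr ⟨Finset.mem_univ _, hlt.trans_le (Finset.card_le_card ?_)⟩
  intro t ht
  obtain ⟨htl, hty⟩ := Finset.mem_filter.mp ht
  exact Finset.mem_filter.mpr ⟨htl, hty ▸ (hf t (Finset.mem_range.mp htl)).1⟩

theorem prodUpTo_nonneg {H m : ℕ} {W : ℕ → Matrix (Fin H) (Fin H) ℝ}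
    (hnonneg : ∀ t < m, ∀ i j, 0 ≤ W t i j) (i j : Fin H) : 0 ≤ prodUpTo H W m i j := by
  induction m generalizing i with
  | zero =>
    rw [prodUpTo, Matrix.one_apply]
    split_ifs <;> norm_num
  | succ m ih =>
    rw [prodUpTo, Matrix.mul_apply]
    exact Finset.sum_nonneg fun k _ => mul_nonneg (hnonneg m (by omega) i k)
      (ih (fun t ht => hnonneg t (by omega)) k)

/-- Further multiplication by row-stochastic matrices preserves a lower bound on a column. -/
theorem le_prodUpTo_of_le {H l m : ℕ} (hlm : l ≤ m) {W : ℕ → Matrix (Fin H) (Fin H) ℝ}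
    (hnonneg : ∀ t < m, ∀ i j, 0 ≤ W t i j) (hrow : ∀ t < m, ∀ i, ∑ j, W t i j = 1)
    {j : Fin H} {c : ℝ} (hc : ∀ i, c ≤ prodUpTo H W l i j) (i : Fin H) :
    c ≤ prodUpTo H W m i j := by
  induction m, hlm using Nat.le_induction generalizing i with
  | base => exact hc i
  | succ m _ ih =>
    have ih := ih (fun t ht => hnonneg t (by omega)) (fun t ht => hrow t (by omega))
    rw [prodUpTo, Matrix.mul_apply]
    calc c = ∑ k, W m i k * c := by rw [← Finset.sum_mul, hrow m (by omega) i, one_mul]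
      _ ≤ _ := Finset.sum_le_sum fun k _ =>
        mul_le_mul_of_nonneg_left (ih k) (hnonneg m (by omega) i k)

theorem pow_succ_le_prodUpTo_succ {H t : ℕ} {W : ℕ → Matrix (Fin H) (Fin H) ℝ}
    (hnonneg : ∀ s < t + 1, ∀ i j, 0 ≤ W s i j) {η : ℝ} (hη : 0 ≤ η) {i j k : Fin H}
    (hW : η ≤ W t i k) (hP : η ^ t ≤ prodUpTo H W t k j) :
    η ^ (t + 1) ≤ prodUpTo H W (t + 1) i j := by
  have hP0 := prodUpTo_nonneg (m := t) fun s hs => hnonneg s (by omega)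
  rw [prodUpTo, Matrix.mul_apply, pow_succ']
  exact (mul_le_mul hW hP (pow_nonneg hη t) (hnonneg t (by omega) i k)).trans
    (Finset.single_le_sum (f := fun k => W t i k * prodUpTo H W t k j)
      (fun k _ => mul_nonneg (hnonneg t (by omega) i k) (hP0 k j)) (Finset.mem_univ k))

/-- The rows in which column `j` of the product of the first `t` matrices is at least `η ^ t`. -/
noncomputable def largeRows {H : ℕ} (W : ℕ → Matrix (Fin H) (Fin H) ℝ) (η : ℝ) (j : Fin H)
    (t : ℕ) : Finset (Fin H) :=
  Finset.univ.filter fun i => η ^ t ≤ prodUpTo H W t i j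

theorem mem_largeRows {H : ℕ} {W : ℕ → Matrix (Fin H) (Fin H) ℝ} {η : ℝ} {j : Fin H} {t : ℕ}
    {i : Fin H} : i ∈ largeRows W η j t ↔ η ^ t ≤ prodUpTo H W t i j := by
  simp [largeRows]

/-- Each time `j` is a root of the current graph, its set of large rows gains an element until it
is everything. -/
theorem self_mem_largeRows_and_min_le_card {H t : ℕ} {W : ℕ → Matrix (Fin H) (Fin H) ℝ}
    {η : ℝ} (hη : 0 ≤ η) (hnonneg : ∀ s < t, ∀ i j, 0 ≤ W s i j)
    (hdiag : ∀ s < t, ∀ i, η ≤ W s i i) {r : ℕ → Finset (Fin H)} {G : ℕ → Fin H → Fin H → Prop}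
    (hr : ∀ s < t, ∀ j ∈ r s, ∀ i, Relation.ReflTransGen (G s) j i)
    (hG : ∀ s < t, ∀ i j, G s i j → η ≤ W s j i) (j : Fin H) :
    j ∈ largeRows W η j t ∧
      min H (((Finset.range t).filter fun s => j ∈ r s).card + 1) ≤ (largeRows W η j t).card := by
  induction t with
  | zero =>
    have h0 : j ∈ largeRows W η j 0 := by simp [mem_largeRows, prodUpTo]
    refine ⟨h0, (min_le_right _ _).trans ?_⟩
    simpa using Finset.card_pos.mpr ⟨j, h0⟩
  | succ t ih =>
    obtain ⟨hj, hcard⟩ := ih (fun s hs => hnonneg s (by omega)) (fun s hs => hdiag s (by omega))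
      (fun s hs => hr s (by omega)) (fun s hs => hG s (by omega))
    have hsub : largeRows W η j t ⊆ largeRows W η j (t + 1) := fun i hi =>
      mem_largeRows.mpr <| pow_succ_le_prodUpTo_succ hnonneg hη (hdiag t (by omega) i)
        (mem_largeRows.mp hi)
    refine ⟨hsub hj, ?_⟩
    have hle := Finset.card_le_card hsub
    rw [Finset.range_add_one, Finset.filter_insert]
    split_ifs with hjr
    · rw [Finset.card_insert_of_notMem (by simp)]
      by_cases hall : ∀ x, x ∈ largeRows W η j t
      · have : (largeRows W η j t).card = H := by
          rw [Finset.eq_univ_iff_forall.mpr hall, Finset.card_univ, Fintype.card_fin]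
        omega
      · push Not at hall
        obtain ⟨x, hx⟩ := hall
        obtain ⟨k, hk, i, hi, hki⟩ := exists_arc_leaving (hr t (by omega) j hjr) hj hx
        have hi' : i ∈ largeRows W η j (t + 1) := mem_largeRows.mpr <|
          pow_succ_le_prodUpTo_succ hnonneg hη (hG t (by omega) k i hki) (mem_largeRows.mp hk)
        have := Finset.card_lt_card (Finset.ssubset_iff_subset_ne.mpr
          ⟨hsub, fun h => hi (h ▸ hi')⟩)
        omega
    · exact hcard.trans hle

theorem stmt15 (H κ : ℕ) (hH : 2 ≤ H) (hκ1 : 1 ≤ κ) (hκH : κ ≤ H)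
    (η : ℝ) (hη0 : 0 < η) (hη1 : η ≤ 1)
    (m : ℕ) (hm : (H - κ + 1) * (H - 2) + 1 ≤ m)
    (W : ℕ → Matrix (Fin H) (Fin H) ℝ)
    (hnonneg : ∀ t < m, ∀ i j, 0 ≤ W t i j)
    (hrow : ∀ t < m, ∀ i, ∑ j, W t i j = 1)
    (hdiag : ∀ t < m, ∀ i, η ≤ W t i i)
    (hG : ∀ t < m, ∃ G : Fin H → Fin H → Prop,
      (∀ i, G i i) ∧
      κ ≤ {i : Fin H | ∀ j, Relation.ReflTransGen G i j}.ncard ∧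
      (∀ i j, G i j → η ≤ W t j i)) :
    ∃ S : Finset (Fin H), κ ≤ S.card ∧
      ∀ i : Fin H, ∀ j ∈ S,
        η ^ ((H - κ + 1) * (H - 2) + 1) ≤ prodUpTo H W m i j := by
  classical
  set l := (H - κ + 1) * (H - 2) + 1 with hl
  choose! G _ hroots harc using hG
  let r : ℕ → Finset (Fin H) := fun t =>
    Finset.univ.filter fun i => ∀ j, Relation.ReflTransGen (G t) i j
  have hr : ∀ t < m, κ ≤ (r t).card := fun t ht => by
    have h := hroots t ht
    rwa [Set.ncard_eq_toFinset_card', Set.toFinset_ofPred] at h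
  have hfreq := le_card_filter_frequent (V := Fin H) (d := H - 2) hκ1 (by simpa using hκH) r
    (fun t ht => hr t (by rw [Fintype.card_fin] at ht; omega))
  rw [Fintype.card_fin, ← hl] at hfreq
  refine ⟨_, hfreq, fun i j hj => ?_⟩
  have hcount := (Finset.mem_filter.mp hj).2
  refine le_prodUpTo_of_le hm hnonneg hrow (fun i => ?_) i
  obtain ⟨-, hcard⟩ := self_mem_largeRows_and_min_le_card (t := l) (r := r) hη0.le
    (fun s hs => hnonneg s (by omega)) (fun s hs => hdiag s (by omega))
    (fun s _ j hj => (Finset.mem_filter.mp hj).2) (fun s hs => harc s (by omega)) j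
  have huniv : largeRows W η j l = Finset.univ := by
    rw [← Finset.card_eq_iff_eq_univ, Fintype.card_fin]
    have hle := Finset.card_le_univ (largeRows W η j l)
    rw [Fintype.card_fin] at hle
    omega
  exact mem_largeRows.mp (huniv ▸ Finset.mem_univ i)
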